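/- arXiv:1301.2567 — 3 statements merged into one kernel-verified Lean document; each statement's English description precedes it below -/
import Mathlib

section
/- Let A ∈ ℂ^{n×p}, B ∈ ℂ^{m×q}, C ∈ ℂ^{n×q}, Hermitian D ∈ ℂ^{n×n} and Hermitian M ∈ ℂ^{q×q} be given, and let φ(X) = (AXB + C)M(AXB + C)* + D for X ∈ ℂ^{p×m}. Then the maximum of i₊(φ(X)) over all X ∈ ℂ^{p×m} equals min{ i₊(N1), i₊(N3) }, and the maximum of i₋(φ(X)) over all X ∈ ℂ^{p×m} equals min{ i₋(N1), i₋(N3) }. -/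
open Matrix

/-- The number of positive eigenvalues (counted with multiplicity) of a
Hermitian complex matrix, i.e. the partial inertia `i₊`. -/
noncomputable def iPos {k : Type*} [Fintype k] [DecidableEq k]
    {A : Matrix k k ℂ} (hA : A.IsHermitian) : ℕ :=
  Nat.card {i // 0 < hA.eigenvalues i}

/-- The number of negative eigenvalues (counted with multiplicity) of a
Hermitian complex matrix, i.e. the partial inertia `i₋`. -/
noncomputable def iNeg {k : Type*} [Fintype k] [DecidableEq k]
    {A : Matrix k k ℂ} (hA : A.IsHermitian) : ℕ :=
  Nat.card {i // hA.eigenvalues i < 0}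

/-- Real part of the quadratic form of a matrix. -/
noncomputable def qf {k : Type*} [Fintype k] (A : Matrix k k ℂ) (v : k → ℂ) : ℝ :=
  (star v ⬝ᵥ A *ᵥ v).re

/-- There is a `k`-dimensional subspace on which the form is positive. -/
def PosDim {I : Type*} [Fintype I] (k : ℕ) (A : Matrix I I ℂ) : Prop :=
  ∃ V : Matrix I (Fin k) ℂ, ∀ x, x ≠ 0 → 0 < qf A (V *ᵥ x)

lemma posDim_iff_aux {I : Type*} [Fintype I] [DecidableEq I] (k : ℕ) (A : Matrix I I ℂ)
    (μ : I → ℝ) (Q R : Matrix I I ℂ) (hQR : Q * R = 1)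
    (h : ∀ v, qf A v = ∑ i, μ i * Complex.normSq ((Q *ᵥ v) i)) :
    k ≤ Nat.card {i // 0 < μ i} ↔ PosDim k A := by
  classical
  rw [Nat.card_eq_fintype_card]
  constructor
  · intro hk
    obtain ⟨e⟩ : Nonempty (Fin k ↪ {i // 0 < μ i}) :=
      Function.Embedding.nonempty_of_card_le (by simpa using hk)
    refine ⟨R * (Matrix.of fun i j => if i = (e j : I) then (1:ℂ) else 0), fun x hx => ?_⟩
    rw [h]
    have hv : Q *ᵥ ((R * (Matrix.of fun i j => if i = (e j : I) then (1:ℂ) else 0)) *ᵥ x)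
        = fun i => ∑ j, if i = (e j : I) then x j else 0 := by
      rw [mulVec_mulVec, ← Matrix.mul_assoc, hQR, Matrix.one_mul]
      ext i
      simp [mulVec, dotProduct]
    rw [hv]
    obtain ⟨j, hj⟩ := Function.ne_iff.mp hx
    refine Finset.sum_pos' (fun i _ => ?_) ⟨(e j : I), Finset.mem_univ _, ?_⟩
    · by_cases hi : 0 < μ i
      · exact mul_nonneg hi.le (Complex.normSq_nonneg _)
      · have : ∀ j, i ≠ (e j : I) := fun j hj => hi (hj ▸ (e j).2)
        simp [this]
    · have : (∑ j', if (e j : I) = (e j' : I) then x j' else 0) = x j := by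
        rw [Finset.sum_eq_single j]
        · simp
        · intro b _ hb
          rw [if_neg]
          intro h'
          exact hb (e.injective (Subtype.ext h')).symm
        · simp
      simp only [this]
      exact mul_pos (e j).2 (Complex.normSq_pos.mpr hj)
  · rintro ⟨V, hV⟩
    by_contra hk
    push Not at hk
    let f : (Fin k → ℂ) →ₗ[ℂ] ({i // 0 < μ i} → ℂ) :=
      (LinearMap.funLeft ℂ ℂ Subtype.val) ∘ₗ (Q * V).mulVecLin
    have hf : LinearMap.ker f ≠ ⊥ := LinearMap.ker_ne_bot_of_finrank_lt (by simpa using hk)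
    obtain ⟨x, hx, hx0⟩ := Submodule.exists_mem_ne_zero_of_ne_bot hf
    have := hV x hx0
    rw [h] at this
    refine absurd this (not_lt.mpr (Finset.sum_nonpos fun i _ => ?_))
    by_cases hi : 0 < μ i
    · have h1 := congrFun (LinearMap.mem_ker.mp hx) ⟨i, hi⟩
      have h2 : (Q *ᵥ V *ᵥ x) i = 0 := by
        simpa [f, LinearMap.funLeft, mulVec_mulVec] using h1
      simp [h2]
    · exact mul_nonpos_of_nonpos_of_nonneg (not_lt.mp hi) (Complex.normSq_nonneg _)

lemma qf_spectral {I : Type*} [Fintype I] [DecidableEq I] {A : Matrix I I ℂ}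
    (hA : A.IsHermitian) (v : I → ℂ) :
    qf A v = ∑ i, hA.eigenvalues i *
      Complex.normSq (((hA.eigenvectorUnitary : Matrix I I ℂ)ᴴ *ᵥ v) i) := by
  have h1 : A = (hA.eigenvectorUnitary : Matrix I I ℂ) *
      diagonal (RCLike.ofReal ∘ hA.eigenvalues) * (hA.eigenvectorUnitary : Matrix I I ℂ)ᴴ := by
    conv_lhs => rw [hA.spectral_theorem, Unitary.conjStarAlgAut_apply]
    rfl
  set U := (hA.eigenvectorUnitary : Matrix I I ℂ)
  have h2 : star v ⬝ᵥ A *ᵥ v = star (Uᴴ *ᵥ v) ⬝ᵥ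
      diagonal (RCLike.ofReal ∘ hA.eigenvalues) *ᵥ (Uᴴ *ᵥ v) := by
    conv_lhs => rw [h1]
    rw [star_mulVec, conjTranspose_conjTranspose, ← dotProduct_mulVec, mulVec_mulVec,
      mulVec_mulVec, Matrix.mul_assoc]
  rw [qf, h2, dotProduct, Complex.re_sum]
  refine Finset.sum_congr rfl fun i _ => ?_
  rw [mulVec_diagonal]
  simp [Complex.normSq_apply]
  ring

lemma le_iPos_iff {I : Type*} [Fintype I] [DecidableEq I] {A : Matrix I I ℂ}
    (hA : A.IsHermitian) (k : ℕ) : k ≤ iPos hA ↔ PosDim k A :=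
  posDim_iff_aux k A hA.eigenvalues _ (hA.eigenvectorUnitary : Matrix I I ℂ)
    (Unitary.coe_star_mul_self hA.eigenvectorUnitary) (qf_spectral hA)

lemma le_iNeg_iff {I : Type*} [Fintype I] [DecidableEq I] {A : Matrix I I ℂ}
    (hA : A.IsHermitian) (k : ℕ) : k ≤ iNeg hA ↔ PosDim k (-A) := by
  have := posDim_iff_aux k (-A) (fun i => - hA.eigenvalues i) _
    (hA.eigenvectorUnitary : Matrix I I ℂ)
    (Unitary.coe_star_mul_self hA.eigenvectorUnitary) (fun v => by
      have := qf_spectral hA v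
      simp only [qf, neg_mulVec, dotProduct_neg, Complex.neg_re, neg_mul,
        Finset.sum_neg_distrib] at this ⊢
      rw [this]; rfl)
  simpa [iNeg] using this

lemma qf_add {I : Type*} [Fintype I] {G : Matrix I I ℂ} (hG : G.IsHermitian) (u v : I → ℂ) :
    qf G (u + v) = qf G u + qf G v + 2 * (star u ⬝ᵥ G *ᵥ v).re := by
  have : star v ⬝ᵥ G *ᵥ u = star (star u ⬝ᵥ G *ᵥ v) := by
    rw [star_dotProduct, star_mulVec, hG.eq, dotProduct_mulVec]
  simp only [qf, star_add, mulVec_add, add_dotProduct, dotProduct_add, this, Complex.add_re]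
  simp
  ring

lemma qf_blocks {I J : Type*} [Fintype I] [Fintype J] (E : Matrix I I ℂ) (F : Matrix I J ℂ)
    (F' : Matrix J I ℂ) (H : Matrix J J ℂ) (u : I → ℂ) (v : J → ℂ) :
    qf (fromBlocks E F F' H) (Sum.elim u v) =
      (star u ⬝ᵥ (E *ᵥ u + F *ᵥ v) + star v ⬝ᵥ (F' *ᵥ u + H *ᵥ v)).re := by
  have : star (Sum.elim u v) = Sum.elim (star u) (star v) := by
    ext i; cases i <;> rfl
  rw [qf, fromBlocks_mulVec, this, sumElim_dotProduct_sumElim]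
  rfl

lemma exists_ginv {p k : ℕ} (L : Matrix (Fin p) (Fin k) ℂ) :
    ∃ g : Matrix (Fin k) (Fin p) ℂ, ∀ c, L *ᵥ g *ᵥ L *ᵥ c = L *ᵥ c := by
  let l := L.mulVecLin
  obtain ⟨s, hs⟩ := l.rangeRestrict.exists_rightInverse_of_surjective l.range_rangeRestrict
  obtain ⟨g, hg⟩ := s.exists_extend
  refine ⟨LinearMap.toMatrix' g, fun c => ?_⟩
  have h1 : g (L *ᵥ c) = s (l.rangeRestrict c) := by
    rw [← hg]; rfl
  rw [LinearMap.toMatrix'_mulVec, h1]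
  exact congrArg Subtype.val (LinearMap.congr_fun hs (l.rangeRestrict c))

lemma exists_tau {p k : ℕ} (L : Matrix (Fin p) (Fin k) ℂ) (K : Submodule ℂ (Fin k → ℂ))
    (h : L.rank ≤ Module.finrank ℂ K) :
    ∃ t : Matrix (Fin k) (Fin p) ℂ, (∀ c, t *ᵥ L *ᵥ c ∈ K) ∧
      ∀ c, t *ᵥ L *ᵥ c = 0 → L *ᵥ c = 0 := by
  let l := L.mulVecLin
  obtain ⟨f, hf⟩ := (finrank_le_iff_exists_linearMap (R := ℂ) (M := LinearMap.range l)
    (M' := K)).mp h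
  obtain ⟨g, hg⟩ := (K.subtype ∘ₗ f).exists_extend
  have h1 : ∀ c, g (L *ᵥ c) = f (l.rangeRestrict c) := by
    intro c
    exact LinearMap.congr_fun hg (l.rangeRestrict c)
  refine ⟨LinearMap.toMatrix' g, fun c => ?_, fun c => ?_⟩
  · rw [LinearMap.toMatrix'_mulVec, h1]; exact (f _).2
  · rw [LinearMap.toMatrix'_mulVec, h1]
    intro hc
    have h2 : f (l.rangeRestrict c) = 0 := Subtype.ext hc
    have h3 := (map_eq_zero_iff f hf).mp h2
    exact congrArg Subtype.val h3

lemma exists_perturb {I : Type*} [Fintype I] {k p : ℕ} (G : Matrix I I ℂ)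
    (F0 F1 : Matrix I (Fin k) ℂ) (h : ∀ x, x ≠ 0 → 0 < qf G (F0 *ᵥ x))
    (N : Matrix (Fin p) (Fin p) ℂ) :
    ∃ e : ℂ, IsUnit (N + e • (1 : Matrix (Fin p) (Fin p) ℂ)) ∧
      ∀ x, x ≠ 0 → 0 < qf G (F0 *ᵥ x + e • F1 *ᵥ x) := by
  have hcont : Continuous fun z : ℂ × (Fin k → ℂ) => qf G (F0 *ᵥ z.2 + z.1 • F1 *ᵥ z.2) := by
    unfold qf
    fun_prop
  have hev : ∀ᶠ e in nhds (0 : ℂ), ∀ x ∈ Metric.sphere (0 : Fin k → ℂ) 1,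
      0 < qf G (F0 *ᵥ x + e • F1 *ᵥ x) := by
    refine (isCompact_sphere (0 : Fin k → ℂ) 1).eventually_forall_of_forall_eventually
      fun y hy => ?_
    refine hcont.continuousAt.eventually (lt_mem_nhds ?_)
    have hy0 : y ≠ 0 := by
      rintro rfl
      simp at hy
    simpa using h y hy0
  have hfin : (spectrum ℂ (-N)).Finite := Matrix.finite_spectrum _
  have hev2 : ∀ᶠ e in nhdsWithin (0 : ℂ) {0}ᶜ, e ∉ spectrum ℂ (-N) := by
    have h1 : ((spectrum ℂ (-N)) \ {0})ᶜ ∈ nhds (0 : ℂ) :=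
      (hfin.subset Set.sdiff_subset).isClosed.isOpen_compl.mem_nhds (by simp)
    filter_upwards [nhdsWithin_le_nhds h1, self_mem_nhdsWithin] with e he he0 hs
    exact he ⟨hs, he0⟩
  obtain ⟨e, he1, he2⟩ := (hev2.and (nhdsWithin_le_nhds hev)).exists
  refine ⟨e, ?_, fun x hx => ?_⟩
  · have := spectrum.notMem_iff.mp he1
    rw [sub_neg_eq_add, Algebra.algebraMap_eq_smul_one] at this
    rwa [add_comm]
  · have hn : (0:ℝ) < ‖x‖ := norm_pos_iff.mpr hx
    have h1 := he2 (((‖x‖⁻¹ : ℝ) : ℂ) • x) (by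
      simp [norm_smul, hn.ne'])
    have h2 : qf G (F0 *ᵥ (((‖x‖⁻¹ : ℝ) : ℂ) • x) + e • F1 *ᵥ (((‖x‖⁻¹ : ℝ) : ℂ) • x))
        = (‖x‖⁻¹ * ‖x‖⁻¹) * qf G (F0 *ᵥ x + e • F1 *ᵥ x) := by
      have : F0 *ᵥ (((‖x‖⁻¹ : ℝ) : ℂ) • x) + e • F1 *ᵥ (((‖x‖⁻¹ : ℝ) : ℂ) • x)
          = ((‖x‖⁻¹ : ℝ) : ℂ) • (F0 *ᵥ x + e • F1 *ᵥ x) := by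
        rw [mulVec_smul, mulVec_smul, smul_add, smul_comm e]
      rw [this, qf, qf, mulVec_smul, star_smul, smul_dotProduct, dotProduct_smul, smul_smul,
        smul_eq_mul]
      rw [show star ((‖x‖⁻¹ : ℝ) : ℂ) = ((‖x‖⁻¹ : ℝ) : ℂ) from Complex.conj_ofReal _,
        ← Complex.ofReal_mul, Complex.re_ofReal_mul]
    rw [h2] at h1
    exact (mul_pos_iff_of_pos_left (by positivity)).mp h1

open scoped ComplexOrder in
lemma core {n m p k : ℕ} (A : Matrix (Fin n) (Fin p) ℂ) (E : Matrix (Fin n) (Fin n) ℂ)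
    (F : Matrix (Fin n) (Fin m) ℂ) (F' : Matrix (Fin m) (Fin n) ℂ) (H : Matrix (Fin m) (Fin m) ℂ)
    (hG : (fromBlocks E F F' H).IsHermitian)
    (h1 : PosDim k (fromBlocks E A Aᴴ 0)) (h3 : PosDim k (fromBlocks E F F' H)) :
    ∃ (Y : Matrix (Fin m) (Fin p) ℂ) (S : Matrix (Fin n) (Fin k) ℂ), ∀ x, x ≠ 0 →
      0 < qf (fromBlocks E F F' H) (Sum.elim (S *ᵥ x) (Y *ᵥ Aᴴ *ᵥ S *ᵥ x)) := by
  obtain ⟨V, hV⟩ := h1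
  obtain ⟨W, hW⟩ := h3
  set G := fromBlocks E F F' H with hGdef
  let U : Matrix (Fin n) (Fin k) ℂ := V.submatrix Sum.inl id
  let T : Matrix (Fin p) (Fin k) ℂ := V.submatrix Sum.inr id
  let a : Matrix (Fin n) (Fin k) ℂ := W.submatrix Sum.inl id
  let b : Matrix (Fin m) (Fin k) ℂ := W.submatrix Sum.inr id
  have hVx : ∀ x, V *ᵥ x = Sum.elim (U *ᵥ x) (T *ᵥ x) := by
    intro x; ext i; cases i <;> rfl
  have hWx : ∀ x, W *ᵥ x = Sum.elim (a *ᵥ x) (b *ᵥ x) := by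
    intro x; ext i; cases i <;> rfl
  let L : Matrix (Fin p) (Fin k) ℂ := Aᴴ * U
  have hL : ∀ x, L *ᵥ x = Aᴴ *ᵥ U *ᵥ x := fun x => (mulVec_mulVec _ _ _).symm
  obtain ⟨g, hg⟩ := exists_ginv L
  let P : Matrix (Fin k) (Fin k) ℂ := 1 - g * L
  have hP : ∀ x, P *ᵥ x = x - g *ᵥ L *ᵥ x := by
    intro x; simp [P, sub_mulVec, mulVec_mulVec]
  have hLP : ∀ x, L *ᵥ P *ᵥ x = 0 := by
    intro x; rw [hP, mulVec_sub, hg, sub_self]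
  -- inclusion of the first component
  let J : Matrix (Fin n ⊕ Fin m) (Fin k) ℂ := fun i j => Sum.elim (fun i => U i j) (fun _ => 0) i
  have hJ : ∀ x, J *ᵥ x = Sum.elim (U *ᵥ x) 0 := by
    intro x; ext i; cases i
    · rfl
    · simp [J, mulVec, dotProduct]
  let K : Matrix (Fin k) (Fin k) ℂ := Pᴴ * (Jᴴ * G * W)
  have hrank : L.rank ≤ Module.finrank ℂ (LinearMap.ker K.mulVecLin) := by
    have e1 : K.rank ≤ P.rank := (rank_mul_le_left _ _).trans (rank_conjTranspose P).le
    have e2 : P.rank ≤ Module.finrank ℂ (LinearMap.ker L.mulVecLin) := by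
      refine Submodule.finrank_mono ?_
      rintro _ ⟨x, rfl⟩
      exact hLP x
    have e3 := LinearMap.finrank_range_add_finrank_ker L.mulVecLin
    have e4 := LinearMap.finrank_range_add_finrank_ker K.mulVecLin
    change L.rank + _ = _ at e3
    change K.rank + _ = _ at e4
    omega
  obtain ⟨t, ht1, ht2⟩ := exists_tau L _ hrank
  have hcross : ∀ x, star (J *ᵥ P *ᵥ x) ⬝ᵥ G *ᵥ W *ᵥ t *ᵥ L *ᵥ x = 0 := by
    intro x
    have h0 : K *ᵥ t *ᵥ L *ᵥ x = 0 := ht1 x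
    have : star (J *ᵥ P *ᵥ x) ⬝ᵥ G *ᵥ W *ᵥ t *ᵥ L *ᵥ x = star x ⬝ᵥ K *ᵥ t *ᵥ L *ᵥ x := by
      simp only [K, star_mulVec, conjTranspose_mul, ← dotProduct_mulVec, mulVec_mulVec, Matrix.mul_assoc]
    rw [this, h0, dotProduct_zero]
  let F0 : Matrix (Fin n ⊕ Fin m) (Fin k) ℂ := J * P + W * t * L
  let F1 : Matrix (Fin n ⊕ Fin m) (Fin k) ℂ := J * g * L
  have hF0 : ∀ x, F0 *ᵥ x = J *ᵥ P *ᵥ x + W *ᵥ t *ᵥ L *ᵥ x := by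
    intro x; simp [F0, add_mulVec, mulVec_mulVec, Matrix.mul_assoc]
  have hF1 : ∀ x, F1 *ᵥ x = J *ᵥ g *ᵥ L *ᵥ x := by
    intro x; simp [F1, mulVec_mulVec, Matrix.mul_assoc]
  have hJP : ∀ x, qf G (J *ᵥ P *ᵥ x) = qf (fromBlocks E A Aᴴ 0) (V *ᵥ P *ᵥ x) := by
    intro x
    have hz : Aᴴ *ᵥ U *ᵥ P *ᵥ x = 0 := by rw [← hL, hLP]
    have hz2 : star (U *ᵥ P *ᵥ x) ⬝ᵥ A *ᵥ T *ᵥ P *ᵥ x = 0 := by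
      have : star (U *ᵥ P *ᵥ x) ᵥ* A = star (Aᴴ *ᵥ U *ᵥ P *ᵥ x) := by
        rw [star_mulVec Aᴴ, conjTranspose_conjTranspose]
      rw [dotProduct_mulVec, this, hz]; simp
    rw [hJ, hVx, hGdef, qf_blocks, qf_blocks, hz,
      dotProduct_add _ (E *ᵥ U *ᵥ P *ᵥ x) (A *ᵥ T *ᵥ P *ᵥ x), hz2]
    simp
  have hpos : ∀ x, x ≠ 0 → 0 < qf G (F0 *ᵥ x) := by
    intro x hx
    rw [hF0, qf_add hG, hcross, hJP]
    simp only [Complex.zero_re, mul_zero, add_zero]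
    have z0 : ∀ {I : Type} [Fintype I] (M : Matrix I I ℂ), qf M 0 = 0 := by
      intro I _ M; simp [qf]
    by_cases hLx : t *ᵥ L *ᵥ x = 0
    · have : P *ᵥ x = x := by rw [hP, ht2 x hLx]; simp
      rw [hLx, this]
      simpa [z0] using hV x hx
    · have h2 := hW _ hLx
      by_cases hPx : P *ᵥ x = 0
      · rw [hPx]; simpa [z0] using h2
      · exact add_pos (hV _ hPx) h2
  obtain ⟨e, he, hepos⟩ := exists_perturb G F0 F1 hpos (Aᴴ * a * t)
  obtain ⟨Ni, hNi⟩ := he.exists_left_inv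
  refine ⟨b * t * Ni, U * P + a * t * L + e • (U * g * L), fun x hx => ?_⟩
  have hS : (U * P + a * t * L + e • (U * g * L)) *ᵥ x =
      U *ᵥ P *ᵥ x + a *ᵥ t *ᵥ L *ᵥ x + e • U *ᵥ g *ᵥ L *ᵥ x := by
    simp [add_mulVec, mulVec_mulVec, Matrix.mul_assoc, smul_mulVec]
  have hAS : Aᴴ *ᵥ (U * P + a * t * L + e • (U * g * L)) *ᵥ x =
      (Aᴴ * a * t + e • (1 : Matrix (Fin p) (Fin p) ℂ)) *ᵥ L *ᵥ x := by
    rw [hS, mulVec_add, mulVec_add, mulVec_smul, ← hL, ← hL, hLP, hg, add_mulVec, smul_mulVec,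
      one_mulVec, zero_add]
    simp [mulVec_mulVec, Matrix.mul_assoc]
  have hY : (b * t * Ni) *ᵥ Aᴴ *ᵥ (U * P + a * t * L + e • (U * g * L)) *ᵥ x =
      b *ᵥ t *ᵥ L *ᵥ x := by
    rw [hAS, mulVec_mulVec _ (b * t * Ni), Matrix.mul_assoc (b * t), hNi, Matrix.mul_one,
      ← mulVec_mulVec]
  rw [hY, hS]
  have := hepos x hx
  rw [hF0, hF1, hJ, hJ, hWx] at this
  convert this using 2
  ext i; cases i <;> simp

lemma main_aux {n m p q : ℕ} (k : ℕ)
    (A : Matrix (Fin n) (Fin p) ℂ) (B : Matrix (Fin m) (Fin q) ℂ)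
    (C : Matrix (Fin n) (Fin q) ℂ) (D : Matrix (Fin n) (Fin n) ℂ)
    (M : Matrix (Fin q) (Fin q) ℂ)
    (hN3 : (fromBlocks (D + C * M * Cᴴ) (C * M * Bᴴ) (B * M * Cᴴ) (B * M * Bᴴ)).IsHermitian) :
    (∃ X : Matrix (Fin p) (Fin m) ℂ, PosDim k ((A * X * B + C) * M * (A * X * B + C)ᴴ + D)) ↔
      PosDim k (fromBlocks (D + C * M * Cᴴ) A Aᴴ 0) ∧
      PosDim k (fromBlocks (D + C * M * Cᴴ) (C * M * Bᴴ) (B * M * Cᴴ) (B * M * Bᴴ)) := by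
  have key : ∀ (X : Matrix (Fin p) (Fin m) ℂ) (u : Fin n → ℂ),
      qf ((A * X * B + C) * M * (A * X * B + C)ᴴ + D) u =
      qf (fromBlocks (D + C * M * Cᴴ) (C * M * Bᴴ) (B * M * Cᴴ) (B * M * Bᴴ))
        (Sum.elim u (Xᴴ *ᵥ Aᴴ *ᵥ u)) := by
    intro X u
    rw [qf_blocks, qf]
    congr 1
    simp only [star_mulVec, conjTranspose_conjTranspose, ← dotProduct_mulVec, mulVec_mulVec,
      ← add_mulVec, mulVec_add, ← dotProduct_add]
    congr 2
    simp only [conjTranspose_add, conjTranspose_mul, Matrix.mul_add, Matrix.add_mul,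
      Matrix.mul_assoc, conjTranspose_conjTranspose]
    abel
  constructor
  · rintro ⟨X, V, hV⟩
    constructor
    · let Z : Matrix (Fin p) (Fin n) ℂ :=
        X * B * M * Cᴴ + (1/2 : ℂ) • (X * B * M * Bᴴ * Xᴴ * Aᴴ)
      refine ⟨Matrix.fromRows V (Z * V), fun x hx => ?_⟩
      have h := hV x hx
      rw [fromRows_mulVec, qf_blocks]
      rw [← mulVec_mulVec]
      set u := V *ᵥ x
      have hM1 : (B * M * Cᴴ)ᴴ = C * M * Bᴴ := by
        have := congrArg Matrix.toBlocks₁₂ hN3.eq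
        rwa [fromBlocks_conjTranspose, toBlocks_fromBlocks₁₂, toBlocks_fromBlocks₁₂] at this
      have hM2 : (B * M * Bᴴ)ᴴ = B * M * Bᴴ := by
        have := congrArg Matrix.toBlocks₂₂ hN3.eq
        rwa [fromBlocks_conjTranspose, toBlocks_fromBlocks₂₂, toBlocks_fromBlocks₂₂] at this
      have hZ : Zᴴ = C * M * Bᴴ * Xᴴ + (1/2 : ℂ) • (A * X * (B * M * Bᴴ) * Xᴴ) := by
        have e1 : Z = X * (B * M * Cᴴ) + (1/2 : ℂ) • (X * (B * M * Bᴴ) * Xᴴ * Aᴴ) := by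
          simp only [Z, Matrix.mul_assoc]
        rw [e1, conjTranspose_add, conjTranspose_mul, hM1, conjTranspose_smul,
          conjTranspose_mul, conjTranspose_mul, conjTranspose_mul, hM2,
          conjTranspose_conjTranspose, conjTranspose_conjTranspose]
        simp [Matrix.mul_assoc]
      convert h using 1
      rw [qf]
      congr 1
      rw [star_mulVec Z, hZ, zero_mulVec, add_zero]
      simp only [← dotProduct_mulVec, mulVec_mulVec,
        ← add_mulVec, mulVec_add, ← dotProduct_add]
      congr 2
      simp only [Z, conjTranspose_add, conjTranspose_mul, Matrix.mul_add, Matrix.add_mul,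
        Matrix.mul_assoc, Matrix.mul_smul, Matrix.smul_mul]
      module
    · refine ⟨Matrix.fromRows V (Xᴴ * Aᴴ * V), fun x hx => ?_⟩
      have h := hV x hx
      rw [key] at h
      rw [fromRows_mulVec]
      simpa [mulVec_mulVec, Matrix.mul_assoc] using h
  · rintro ⟨h1, h3⟩
    obtain ⟨Y, S, h⟩ := core A _ _ _ _ hN3 h1 h3
    refine ⟨Yᴴ, S, fun x hx => ?_⟩
    rw [key, conjTranspose_conjTranspose]
    exact h x hx

lemma posDim_flip {n p : ℕ} (k : ℕ) (E : Matrix (Fin n) (Fin n) ℂ) (A : Matrix (Fin n) (Fin p) ℂ)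
    (h : PosDim k (fromBlocks E A Aᴴ 0)) : PosDim k (fromBlocks E (-A) (-Aᴴ) 0) := by
  obtain ⟨V, hV⟩ := h
  refine ⟨Matrix.fromRows (V.submatrix Sum.inl id) (-(V.submatrix Sum.inr id)), fun x hx => ?_⟩
  have h1 := hV x hx
  have hVx : V *ᵥ x = Sum.elim (V.submatrix Sum.inl id *ᵥ x) (V.submatrix Sum.inr id *ᵥ x) := by
    ext i; cases i <;> rfl
  rw [hVx, qf_blocks] at h1
  rw [fromRows_mulVec, qf_blocks]
  simpa [neg_mulVec, mulVec_neg] using h1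

lemma greatest_aux {X : Type*} (f : X → ℕ) (a b : ℕ)
    (h : ∀ k, (∃ x, k ≤ f x) ↔ k ≤ a ∧ k ≤ b) : IsGreatest (Set.range f) (min a b) := by
  have hub : ∀ x, f x ≤ min a b := fun x => le_min_iff.mpr ((h _).mp ⟨x, le_rfl⟩)
  obtain ⟨x, hx⟩ := (h (min a b)).mpr ⟨min_le_left _ _, min_le_right _ _⟩
  refine ⟨⟨x, le_antisymm (hub x) hx⟩, ?_⟩
  rintro _ ⟨y, rfl⟩
  exact hub y

theorem stmt2 {n m p q : ℕ}
    (A : Matrix (Fin n) (Fin p) ℂ) (B : Matrix (Fin m) (Fin q) ℂ)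
    (C : Matrix (Fin n) (Fin q) ℂ) (D : Matrix (Fin n) (Fin n) ℂ)
    (M : Matrix (Fin q) (Fin q) ℂ)
    (hD : D.IsHermitian) (hM : M.IsHermitian)
    (hφ : ∀ X : Matrix (Fin p) (Fin m) ℂ,
      ((A * X * B + C) * M * (A * X * B + C)ᴴ + D).IsHermitian)
    (hN1 : (fromBlocks (D + C * M * Cᴴ) A Aᴴ 0).IsHermitian)
    (hN3 : (fromBlocks (D + C * M * Cᴴ) (C * M * Bᴴ) (B * M * Cᴴ) (B * M * Bᴴ)).IsHermitian) :
    IsGreatest (Set.range fun X : Matrix (Fin p) (Fin m) ℂ => iPos (hφ X))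
      (min (iPos hN1) (iPos hN3)) ∧
    IsGreatest (Set.range fun X : Matrix (Fin p) (Fin m) ℂ => iNeg (hφ X))
      (min (iNeg hN1) (iNeg hN3)) := by
  refine ⟨greatest_aux _ _ _ fun k => ?_, greatest_aux _ _ _ fun k => ?_⟩
  · simp only [le_iPos_iff]
    exact main_aux k A B C D M hN3
  · simp only [le_iNeg_iff]
    have hN3' : (fromBlocks (-D + C * (-M) * Cᴴ) (C * (-M) * Bᴴ) (B * (-M) * Cᴴ)
        (B * (-M) * Bᴴ)) =
        -(fromBlocks (D + C * M * Cᴴ) (C * M * Bᴴ) (B * M * Cᴴ) (B * M * Bᴴ)) := by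
      rw [fromBlocks_neg]
      congr 1 <;> simp [add_comm]
    have h := main_aux k A B C (-D) (-M) (by rw [hN3']; exact hN3.neg)
    rw [hN3'] at h
    have e1 : ∀ X : Matrix (Fin p) (Fin m) ℂ,
        (A * X * B + C) * (-M) * (A * X * B + C)ᴴ + -D =
        -((A * X * B + C) * M * (A * X * B + C)ᴴ + D) := by
      intro X
      rw [neg_add, Matrix.mul_neg, Matrix.neg_mul]
    have e2 : -D + C * (-M) * Cᴴ = -(D + C * M * Cᴴ) := by
      rw [neg_add, Matrix.mul_neg, Matrix.neg_mul]
    simp only [e1] at h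
    rw [e2] at h
    rw [h, fromBlocks_neg _ A, neg_zero]
    refine and_congr_left fun _ => ⟨posDim_flip k _ A, fun h' => ?_⟩
    have := posDim_flip k _ (-A) (by rwa [conjTranspose_neg])
    simpa using this
end

section
/- Let A ∈ ℂ^{n×p}, B ∈ ℂ^{m×q}, C ∈ ℂ^{n×q}, Hermitian D ∈ ℂ^{n×n} and Hermitian M ∈ ℂ^{q×q} be given with A ≠ 0 and BMB* ≠ 0, and let φ(X) = (AXB + C)M(AXB + C)* + D for X ∈ ℂ^{p×m}. Then there exists an X ∈ ℂ^{p×m} such that φ(X) ≻ 0 (positive definite) if and only if either (i₊(N1) = n and i₊(N3) ≥ n) or (i₊(N1) ≥ n and i₊(N3) = n). -/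
open Matrix
open scoped ComplexOrder

open Module
theorem basis_aux {n : ℕ} (K : Submodule ℂ (Fin n → ℂ)) :
    ∃ B : Matrix (Fin n) (Fin (finrank ℂ K)) ℂ, ∀ v ∈ K, ∃ c, B *ᵥ c = v := by
  let e := (finBasis ℂ K).equivFun
  refine ⟨LinearMap.toMatrix' (K.subtype ∘ₗ e.symm.toLinearMap), fun v hv => ⟨e ⟨v,hv⟩, ?_⟩⟩
  simp [-Basis.equivFun_symm_apply, LinearMap.toMatrix'_mulVec]

theorem factor_aux {n m p : ℕ} (S : Matrix (Fin p) (Fin n) ℂ) (L : Matrix (Fin m) (Fin n) ℂ)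
    (h : ∀ v, S *ᵥ v = 0 → L *ᵥ v = 0) : ∃ Y : Matrix (Fin m) (Fin p) ℂ, Y * S = L := by
  obtain ⟨g, hg⟩ := LinearMap.exists_extend ((LinearMap.ker S.mulVecLin).liftQ L.mulVecLin (by intro v; simpa using h v) ∘ₗ
     (S.mulVecLin.quotKerEquivRange.symm.toLinearMap))
  refine ⟨LinearMap.toMatrix' g, ?_⟩
  apply Matrix.ext_of_mulVec_single
  intro i
  rw [← mulVec_mulVec, LinearMap.toMatrix'_mulVec]
  have := LinearMap.congr_fun hg ⟨S.mulVecLin (Pi.single i 1), LinearMap.mem_range_self _ _⟩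
  have h2 := S.mulVecLin.quotKerEquivRange_symm_apply_image (Pi.single i 1) (LinearMap.mem_range_self _ _)
  simp only [LinearMap.comp_apply, LinearEquiv.coe_coe] at this
  erw [h2] at this
  simpa using this

theorem quad_conj {k l : Type*} [Fintype k] [Fintype l] (N : Matrix k k ℂ) (V : Matrix k l ℂ) (x : l → ℂ) :
    star x ⬝ᵥ (Vᴴ * N * V) *ᵥ x = star (V *ᵥ x) ⬝ᵥ N *ᵥ (V *ᵥ x) := by
  simp only [star_mulVec, dotProduct_mulVec, vecMul_vecMul]

theorem exists_of_le_iPos {k : Type*} [Fintype k] [DecidableEq k] {N : Matrix k k ℂ}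
    (hN : N.IsHermitian) {n : ℕ} (h : n ≤ iPos hN) :
    ∃ V : Matrix k (Fin n) ℂ, (Vᴴ * N * V).PosDef := by
  classical
  rw [iPos, Nat.card_eq_fintype_card] at h
  obtain ⟨e⟩ : Nonempty (Fin n ↪ {i // 0 < hN.eigenvalues i}) :=
    Function.Embedding.nonempty_of_card_le (by simpa using h)
  have hs := hN.conjStarAlgAut_star_eigenvectorUnitary
  simp only [Unitary.conjStarAlgAut_apply, Unitary.coe_star, star_star] at hs
  refine ⟨(hN.eigenvectorUnitary : Matrix k k ℂ).submatrix id (fun i => (e i).1), ?_⟩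
  have : ((hN.eigenvectorUnitary : Matrix k k ℂ).submatrix id (fun i => (e i).1))ᴴ * N *
      ((hN.eigenvectorUnitary : Matrix k k ℂ).submatrix id (fun i => (e i).1))
      = (diagonal (RCLike.ofReal ∘ hN.eigenvalues) : Matrix k k ℂ).submatrix (fun i => (e i).1) (fun i => (e i).1) := by
    rw [← hs]
    rfl
  rw [this, submatrix_diagonal _ _ (fun a b hab => e.injective (Subtype.ext hab))]
  apply PosDef.diagonal
  intro i
  simpa using (e i).2

theorem le_iPos_of_posDef {k : Type*} [Fintype k] [DecidableEq k] {N : Matrix k k ℂ}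
    (hN : N.IsHermitian) {n : ℕ} (V : Matrix k (Fin n) ℂ) (hV : (Vᴴ * N * V).PosDef) :
    n ≤ iPos hN := by
  classical
  by_contra hlt
  rw [iPos, Nat.card_eq_fintype_card] at hlt
  push Not at hlt
  set U := (hN.eigenvectorUnitary : Matrix k k ℂ)
  let W : Matrix {i // 0 < hN.eigenvalues i} (Fin n) ℂ := (Uᴴ * V).submatrix Subtype.val id
  have hk : LinearMap.ker W.mulVecLin ≠ ⊥ := LinearMap.ker_ne_bot_of_finrank_lt (by simpa using hlt)
  obtain ⟨x, hx, hx0⟩ := Submodule.exists_mem_ne_zero_of_ne_bot hk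
  have h1 := hV.dotProduct_mulVec_pos hx0
  rw [quad_conj] at h1
  have hs := hN.spectral_theorem
  simp only [Unitary.conjStarAlgAut_apply] at hs
  have hs' : N = Uᴴᴴ * diagonal (RCLike.ofReal ∘ hN.eigenvalues) * Uᴴ := by
    rw [conjTranspose_conjTranspose]; exact hs
  rw [hs', quad_conj, mulVec_mulVec] at h1
  have hy : ∀ i, 0 < hN.eigenvalues i → ((Uᴴ * V) *ᵥ x) i = 0 := fun i hi =>
    congrFun (LinearMap.mem_ker.1 hx) ⟨i, hi⟩
  refine absurd h1 (not_lt_of_ge ?_)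
  rw [dotProduct]
  apply Finset.sum_nonpos
  intro i _
  rw [mulVec_diagonal]
  by_cases hi : 0 < hN.eigenvalues i
  · simp [hy i hi]
  · have h3 : star (((Uᴴ * V) *ᵥ x) i) * ((Uᴴ * V) *ᵥ x) i = ((Complex.normSq (((Uᴴ * V) *ᵥ x) i) : ℝ) : ℂ) := by
      rw [Complex.normSq_eq_conj_mul_self]; rfl
    have : star ((Uᴴ * V) *ᵥ x) i * ((RCLike.ofReal ∘ hN.eigenvalues) i * ((Uᴴ * V) *ᵥ x) i)
      = ((hN.eigenvalues i * Complex.normSq (((Uᴴ * V) *ᵥ x) i) : ℝ) : ℂ) := by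
      push_cast
      rw [← h3]
      simp only [Pi.star_apply, Function.comp, Complex.coe_algebraMap, RCLike.ofReal]
      ring
    rw [this]
    exact_mod_cast mul_nonpos_of_nonpos_of_nonneg (not_lt.1 hi) (Complex.normSq_nonneg _)

theorem key_aux {k : Type*} [Fintype k] {N : Matrix k k ℂ} (hN : N.IsHermitian) {n : ℕ}
    (J U : Matrix k (Fin n) ℂ) (K : Submodule ℂ (Fin n → ℂ))
    (hK : ∀ v ∈ K, v ≠ 0 → 0 < star (J *ᵥ v) ⬝ᵥ N *ᵥ (J *ᵥ v))
    (hU : (Uᴴ * N * U).PosDef) :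
    ∃ F : Matrix k (Fin n) ℂ, (Fᴴ * N * F).PosDef ∧ ∀ v ∈ K, F *ᵥ v = J *ᵥ v := by
  obtain ⟨B, hB⟩ := basis_aux K
  obtain ⟨K', hc⟩ := K.exists_isCompl
  let Ψ := ((B)ᴴ * (Jᴴ * N * U)).mulVecLin
  have hle : finrank ℂ K' ≤ finrank ℂ (LinearMap.ker Ψ) := by
    have h1 := Submodule.finrank_add_eq_of_isCompl hc
    have h2 := Ψ.finrank_range_add_finrank_ker
    have h3 := (LinearMap.range Ψ).finrank_le
    simp at h1 h2 h3
    omega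
  obtain ⟨g, hg⟩ := finrank_le_iff_exists_linearMap.mp hle
  let f : (Fin n → ℂ) →ₗ[ℂ] (k → ℂ) := J.mulVecLin ∘ₗ K.subtype ∘ₗ K.projectionOnto K' hc +
    U.mulVecLin ∘ₗ (LinearMap.ker Ψ).subtype ∘ₗ g ∘ₗ K'.projectionOnto K hc.symm
  refine ⟨LinearMap.toMatrix' f, ?_, ?_⟩
  · refine PosDef.of_dotProduct_mulVec_pos (isHermitian_conjTranspose_mul_mul _ hN) fun x hx => ?_
    rw [quad_conj, LinearMap.toMatrix'_mulVec]
    set a := K.projectionOnto K' hc x with ha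
    set b := K'.projectionOnto K hc.symm x with hb
    have hab : (a : Fin n → ℂ) + b = x := by
      simpa [ha, hb] using Submodule.projection_add_projection_eq_self hc x
    have hf : f x = J *ᵥ (a : Fin n → ℂ) + U *ᵥ (g b : Fin n → ℂ) := rfl
    obtain ⟨c, hcc⟩ := hB a a.2
    have hcross : star (J *ᵥ (a : Fin n → ℂ)) ⬝ᵥ N *ᵥ (U *ᵥ (g b : Fin n → ℂ)) = 0 := by
      have : (Bᴴ * (Jᴴ * N * U)) *ᵥ (g b : Fin n → ℂ) = 0 := (g b).2
      rw [← hcc]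
      have h4 : star c ⬝ᵥ (Bᴴ * (Jᴴ * N * U)) *ᵥ (g b : Fin n → ℂ) = 0 := by rw [this]; simp
      rw [← h4]
      simp only [star_mulVec, dotProduct_mulVec, vecMul_vecMul, Matrix.mul_assoc]
    have hcross2 : star (U *ᵥ (g b : Fin n → ℂ)) ⬝ᵥ N *ᵥ (J *ᵥ (a : Fin n → ℂ)) = 0 := by
      have := congrArg star hcross
      rw [star_zero, star_dotProduct, star_star, star_mulVec, hN.eq, ← dotProduct_mulVec] at this
      simpa using this
    rw [hf, star_add, mulVec_add, add_dotProduct, dotProduct_add, dotProduct_add, hcross, hcross2, add_zero, zero_add]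
    have hUp : ∀ y, y ≠ 0 → 0 < star (U *ᵥ y) ⬝ᵥ N *ᵥ (U *ᵥ y) := fun y hy => by
      rw [← quad_conj]; exact hU.dotProduct_mulVec_pos hy
    by_cases ha0 : (a : Fin n → ℂ) = 0
    · have hb0 : (g b : Fin n → ℂ) ≠ 0 := by
        intro h
        have : b = 0 := hg (by rw [map_zero]; exact Subtype.ext h)
        apply hx
        rw [← hab, ha0, this]; simp
      rw [ha0]
      simpa using hUp _ hb0
    · by_cases hb0 : (g b : Fin n → ℂ) = 0
      · rw [hb0]; simpa using hK a a.2 ha0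
      · exact add_pos (hK a a.2 ha0) (hUp _ hb0)
  · intro v hv
    rw [LinearMap.toMatrix'_mulVec]
    have h1 : K.projectionOnto K' hc v = ⟨v, hv⟩ := Submodule.projectionOnto_apply_left hc ⟨v, hv⟩
    have h2 : K'.projectionOnto K hc.symm v = 0 := Submodule.projectionOnto_apply_right hc.symm ⟨v, hv⟩
    simp [f, h1, h2]

open Filter Topology in
theorem perturb_aux {k : Type*} [Fintype k] {N : Matrix k k ℂ} (hN : N.IsHermitian) {n : ℕ}
    (F J : Matrix k (Fin n) ℂ) (hF : (Fᴴ * N * F).PosDef) :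
    ∀ᶠ t : ℂ in 𝓝 0, ((F - t • J)ᴴ * N * (F - t • J)).PosDef := by
  have hcp : IsCompact (Metric.sphere (0 : Fin n → ℂ) 1) := isCompact_sphere _ _
  have hc : Continuous fun z : ℂ × (Fin n → ℂ) =>
      (star ((F - z.1 • J) *ᵥ z.2) ⬝ᵥ N *ᵥ ((F - z.1 • J) *ᵥ z.2)).re := by
    fun_prop
  have := hcp.eventually_forall_of_forall_eventually (x₀ := (0 : ℂ))
    (P := fun t x => 0 < (star ((F - t • J) *ᵥ x) ⬝ᵥ N *ᵥ ((F - t • J) *ᵥ x)).re) (by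
      intro y hy
      have hy0 : y ≠ 0 := by rintro rfl; simp at hy
      have h := hF.re_dotProduct_pos hy0
      rw [quad_conj] at h
      exact (hc.tendsto (0, y)).eventually_const_lt (by simpa using h))
  filter_upwards [this] with t ht
  have hH := isHermitian_conjTranspose_mul_mul (F - t • J) hN
  refine PosDef.of_dotProduct_mulVec_pos hH fun x hx => ?_
  have him := hH.im_star_dotProduct_mulVec_self x
  have hpos : 0 < (star x ⬝ᵥ ((F - t • J)ᴴ * N * (F - t • J)) *ᵥ x).re := by
    have hn : ‖x‖ ≠ 0 := by simpa using hx
    have h5 := ht ((‖x‖⁻¹ : ℂ) • x) (by simp [norm_smul, hn])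
    rw [mulVec_smul, mulVec_smul, star_smul, smul_dotProduct, dotProduct_smul, ← quad_conj] at h5
    have h6 : (0:ℝ) < ‖x‖⁻¹ * (‖x‖⁻¹ * (star x ⬝ᵥ ((F - t • J)ᴴ * N * (F - t • J)) *ᵥ x).re) := by
      rw [← Complex.re_ofReal_mul, ← Complex.re_ofReal_mul]
      simpa using h5
    have : 0 < ‖x‖⁻¹ := by positivity
    exact pos_of_mul_pos_right (pos_of_mul_pos_right h6 this.le) this.le
  rw [Complex.lt_def]
  exact ⟨by simpa using hpos, by simpa using him.symm⟩

open Filter Topology in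
theorem det_aux {n : ℕ} (G : Matrix (Fin n) (Fin n) ℂ) :
    ∀ᶠ t : ℂ in 𝓝[≠] 0, (G - t • (1 : Matrix (Fin n) (Fin n) ℂ)).det ≠ 0 := by
  have hfin : {t : ℂ | G.charpoly.IsRoot t}.Finite :=
    Polynomial.finite_setOfPred_isRoot G.charpoly_monic.ne_zero
  have h : ∀ᶠ t in 𝓝[≠] (0 : ℂ), t ∉ {t : ℂ | G.charpoly.IsRoot t} := by
    have : 𝓝[≠] (0 : ℂ) ≤ cofinite := nhdsNE_le_cofinite 0
    exact this hfin.compl_mem_cofinite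
  filter_upwards [h] with t ht hdet
  apply ht
  simp only [Polynomial.IsRoot, eval_charpoly]
  rw [← neg_sub, det_neg, scalar_apply, ← smul_one_eq_diagonal, hdet]
  simp


theorem rows_conj {n m l : ℕ} (a : Matrix (Fin n) (Fin n) ℂ) (b : Matrix (Fin n) (Fin m) ℂ)
    (c : Matrix (Fin m) (Fin n) ℂ) (d : Matrix (Fin m) (Fin m) ℂ)
    (V₁ : Matrix (Fin n) (Fin l) ℂ) (V₂ : Matrix (Fin m) (Fin l) ℂ) :
    (fromRows V₁ V₂)ᴴ * fromBlocks a b c d * fromRows V₁ V₂ =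
      V₁ᴴ * a * V₁ + V₁ᴴ * b * V₂ + V₂ᴴ * c * V₁ + V₂ᴴ * d * V₂ := by
  rw [conjTranspose_fromRows_eq_fromCols_conjTranspose, fromCols_mul_fromBlocks,
    fromCols_mul_fromRows, Matrix.add_mul, Matrix.add_mul]
  abel

theorem quad_blocks {n m : ℕ} (a : Matrix (Fin n) (Fin n) ℂ) (b : Matrix (Fin n) (Fin m) ℂ)
    (c : Matrix (Fin m) (Fin n) ℂ) (d : Matrix (Fin m) (Fin m) ℂ) (v : Fin n → ℂ) (w : Fin m → ℂ) :
    star (Sum.elim v w) ⬝ᵥ fromBlocks a b c d *ᵥ (Sum.elim v w) =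
      star v ⬝ᵥ a *ᵥ v + star v ⬝ᵥ b *ᵥ w + (star w ⬝ᵥ c *ᵥ v + star w ⬝ᵥ d *ᵥ w) := by
  rw [fromBlocks_mulVec, Function.star_sumElim, sumElim_dotProduct_sumElim]
  simp [dotProduct_add]

theorem N1_le {n p : ℕ} {E : Matrix (Fin n) (Fin n) ℂ} {A : Matrix (Fin n) (Fin p) ℂ}
    (h : (fromBlocks E A Aᴴ 0).IsHermitian) : iPos h ≤ n := by
  by_contra hlt
  obtain ⟨V, hV⟩ := exists_of_le_iPos h (n := n + 1) (by omega)
  rw [← fromRows_toRows V] at hV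
  have hk : LinearMap.ker V.toRows₁.mulVecLin ≠ ⊥ :=
    LinearMap.ker_ne_bot_of_finrank_lt (by simp)
  obtain ⟨x, hx, hx0⟩ := Submodule.exists_mem_ne_zero_of_ne_bot hk
  have hx' : V.toRows₁ *ᵥ x = 0 := hx
  have h1 := hV.dotProduct_mulVec_pos hx0
  rw [quad_conj, fromRows_mulVec, hx', quad_blocks] at h1
  simp at h1

theorem N1_pos {n p : ℕ} {E : Matrix (Fin n) (Fin n) ℂ} {A : Matrix (Fin n) (Fin p) ℂ}
    (h : (fromBlocks E A Aᴴ 0).IsHermitian) (hn : n ≤ iPos h) (v : Fin n → ℂ)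
    (hv : Aᴴ *ᵥ v = 0) (hv0 : v ≠ 0) : 0 < star v ⬝ᵥ E *ᵥ v := by
  obtain ⟨V, hV⟩ := exists_of_le_iPos h hn
  rw [← fromRows_toRows V] at hV
  have hinj : Function.Injective V.toRows₁.mulVecLin := by
    rw [injective_iff_map_eq_zero]
    intro x hx
    by_contra hx0
    have hx' : V.toRows₁ *ᵥ x = 0 := hx
    have h1 := hV.dotProduct_mulVec_pos hx0
    rw [quad_conj, fromRows_mulVec, hx', quad_blocks] at h1
    simp at h1
  obtain ⟨x, hx⟩ := LinearMap.injective_iff_surjective.1 hinj v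
  have hx' : V.toRows₁ *ᵥ x = v := hx
  have hx0 : x ≠ 0 := by
    rintro rfl
    exact hv0 (by simpa using hx'.symm)
  have h1 := hV.dotProduct_mulVec_pos hx0
  rw [quad_conj, fromRows_mulVec, hx', quad_blocks, hv] at h1
  have h2 : star v ⬝ᵥ A *ᵥ (V.toRows₂ *ᵥ x) = 0 := by
    have := congrArg star hv
    rw [star_mulVec, conjTranspose_conjTranspose, star_zero] at this
    rw [dotProduct_mulVec, this, zero_dotProduct]
  rw [h2] at h1
  simpa using h1

theorem phi_eq {n m p q : ℕ}
    (A : Matrix (Fin n) (Fin p) ℂ) (B : Matrix (Fin m) (Fin q) ℂ)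
    (C : Matrix (Fin n) (Fin q) ℂ) (D : Matrix (Fin n) (Fin n) ℂ)
    (M : Matrix (Fin q) (Fin q) ℂ) (X : Matrix (Fin p) (Fin m) ℂ) :
    (fromRows (1 : Matrix (Fin n) (Fin n) ℂ) (Xᴴ * Aᴴ))ᴴ * fromBlocks (D + C * M * Cᴴ) (C * M * Bᴴ) (B * M * Cᴴ) (B * M * Bᴴ) *
      fromRows (1 : Matrix (Fin n) (Fin n) ℂ) (Xᴴ * Aᴴ) = (A * X * B + C) * M * (A * X * B + C)ᴴ + D := by
  rw [rows_conj]
  simp only [conjTranspose_one, conjTranspose_mul, conjTranspose_conjTranspose, conjTranspose_add,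
    Matrix.one_mul, Matrix.mul_one, Matrix.add_mul, Matrix.mul_add, Matrix.mul_assoc]
  abel

theorem phi_eq1 {n m p q : ℕ}
    (A : Matrix (Fin n) (Fin p) ℂ) (B : Matrix (Fin m) (Fin q) ℂ)
    (C : Matrix (Fin n) (Fin q) ℂ) (D : Matrix (Fin n) (Fin n) ℂ)
    (M : Matrix (Fin q) (Fin q) ℂ) (hM : M.IsHermitian) (X : Matrix (Fin p) (Fin m) ℂ) :
    (fromRows (1 : Matrix (Fin n) (Fin n) ℂ) (X * B * M * Cᴴ + (1 / 2 : ℂ) • (X * B * M * Bᴴ * Xᴴ * Aᴴ)))ᴴ *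
      fromBlocks (D + C * M * Cᴴ) A Aᴴ 0 *
      fromRows (1 : Matrix (Fin n) (Fin n) ℂ) (X * B * M * Cᴴ + (1 / 2 : ℂ) • (X * B * M * Bᴴ * Xᴴ * Aᴴ)) =
      (A * X * B + C) * M * (A * X * B + C)ᴴ + D := by
  rw [rows_conj]
  simp only [conjTranspose_one, conjTranspose_mul, conjTranspose_conjTranspose, conjTranspose_add,
    conjTranspose_smul, hM.eq, Matrix.smul_mul, Matrix.mul_smul, Matrix.mul_zero, Matrix.zero_mul,
    Matrix.one_mul, Matrix.mul_one, Matrix.add_mul, Matrix.mul_add, Matrix.mul_assoc]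
  have : star (1 / 2 : ℂ) = 1 / 2 := by simp
  rw [this]
  module

theorem stmt5 {n m p q : ℕ}
    (A : Matrix (Fin n) (Fin p) ℂ) (B : Matrix (Fin m) (Fin q) ℂ)
    (C : Matrix (Fin n) (Fin q) ℂ) (D : Matrix (Fin n) (Fin n) ℂ)
    (M : Matrix (Fin q) (Fin q) ℂ)
    (hD : D.IsHermitian) (hM : M.IsHermitian)
    (hA : A ≠ 0) (hBMB : B * M * Bᴴ ≠ 0)
    (hN1 : (fromBlocks (D + C * M * Cᴴ) A Aᴴ 0).IsHermitian)
    (hN3 : (fromBlocks (D + C * M * Cᴴ) (C * M * Bᴴ) (B * M * Cᴴ) (B * M * Bᴴ)).IsHermitian) :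
    (∃ X : Matrix (Fin p) (Fin m) ℂ,
        ((A * X * B + C) * M * (A * X * B + C)ᴴ + D).PosDef) ↔
      (iPos hN1 = n ∧ n ≤ iPos hN3) ∨ (n ≤ iPos hN1 ∧ iPos hN3 = n) := by
  constructor
  · rintro ⟨X, hX⟩
    refine Or.inl ⟨le_antisymm (N1_le hN1) ?_, ?_⟩
    · rw [← phi_eq1 A B C D M hM X] at hX
      exact le_iPos_of_posDef hN1 _ hX
    · rw [← phi_eq A B C D M X] at hX
      exact le_iPos_of_posDef hN3 _ hX
  · intro h
    have h1 : n ≤ iPos hN1 := by omega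
    have h3 : n ≤ iPos hN3 := by omega
    obtain ⟨U, hU⟩ := exists_of_le_iPos hN3 h3
    let J : Matrix (Fin n ⊕ Fin m) (Fin n) ℂ := fromRows 1 0
    obtain ⟨F, hF, hFK⟩ := key_aux hN3 J U (LinearMap.ker Aᴴ.mulVecLin) (by
      intro v hv hv0
      have := N1_pos hN1 h1 v hv hv0
      rw [fromRows_mulVec, quad_blocks]
      simpa using this) hU
    have e1 := (perturb_aux hN3 F J hF).filter_mono (nhdsWithin_le_nhds (s := {0}ᶜ))
    have e2 := det_aux F.toRows₁
    have e3 : ∀ᶠ t : ℂ in nhdsWithin 0 {0}ᶜ, t ≠ 1 :=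
      (eventually_ne_nhds (zero_ne_one)).filter_mono nhdsWithin_le_nhds
    obtain ⟨t, ⟨hpd, hdet⟩, ht1⟩ := ((e1.and e2).and e3).exists
    set G := F.toRows₁ - t • (1 : Matrix (Fin n) (Fin n) ℂ) with hG
    have hGu : IsUnit G.det := isUnit_iff_ne_zero.2 hdet
    have hFt : F - t • J = fromRows G F.toRows₂ := by
      ext i j
      rcases i with i | i <;> simp [J, hG, toRows₁, toRows₂]
    obtain ⟨Y, hY⟩ := factor_aux Aᴴ (F.toRows₂ * G⁻¹) (by
      intro v hv
      have h4 := hFK v hv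
      rw [← fromRows_toRows F, fromRows_mulVec, fromRows_mulVec] at h4
      have h5 : F.toRows₁ *ᵥ v = v := by
        have := congrArg (fun f => f ∘ Sum.inl) h4
        simpa using this
      have h6 : F.toRows₂ *ᵥ v = 0 := by
        have := congrArg (fun f => f ∘ Sum.inr) h4
        simpa using this
      have h7 : G *ᵥ v = (1 - t) • v := by
        rw [hG, sub_mulVec, h5, smul_mulVec, one_mulVec, sub_smul, one_smul]
      have h8 : (1 - t) • (G⁻¹ *ᵥ v) = v := by
        rw [← mulVec_smul, ← h7, mulVec_mulVec, nonsing_inv_mul _ hGu, one_mulVec]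
      have h9 : (1 - t) • ((F.toRows₂ * G⁻¹) *ᵥ v) = 0 := by
        rw [← mulVec_mulVec, ← mulVec_smul, h8, h6]
      exact (smul_eq_zero.1 h9).resolve_left (sub_ne_zero.2 ht1.symm))
    refine ⟨Yᴴ, ?_⟩
    rw [← phi_eq A B C D M, conjTranspose_conjTranspose, hY]
    have hVV : fromRows (1 : Matrix (Fin n) (Fin n) ℂ) (F.toRows₂ * G⁻¹) = (F - t • J) * G⁻¹ := by
      rw [hFt, fromRows_mul, mul_nonsing_inv _ hGu]
    have hinj : Function.Injective (G⁻¹ *ᵥ ·) := by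
      apply mulVec_injective_of_isUnit
      rw [isUnit_nonsing_inv_iff, isUnit_iff_isUnit_det]
      exact hGu
    have := hpd.conjTranspose_mul_mul_same hinj
    rw [hVV, conjTranspose_mul]
    simpa only [Matrix.mul_assoc] using this
end

section
/- Let A ∈ ℂ^{n×p}, B ∈ ℂ^{m×q}, C ∈ ℂ^{n×q}, Hermitian D ∈ ℂ^{n×n} and Hermitian M ∈ ℂ^{q×q} be given with A ≠ 0, and let φ(X) = (AXB + C)M(AXB + C)* + D for X ∈ ℂ^{p×m}. Then there exists an X̃ ∈ ℂ^{p×m} such that φ(X) ⪯ φ(X̃) for all X ∈ ℂ^{p×m} (a global maximizer in the Löwner partial ordering) if and only if BMB* ⪯ 0, ℛ(CMB*) ⊆ ℛ(A), and ℛ(BMC*) ⊆ ℛ(BMB*). Moreover, under these conditions, X̃ is such a global maximizer if and only if A X̃ BMB* + CMB* = 0. -/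
open Matrix
open scoped ComplexOrder

theorem aux_inner_inv {a b : ℕ} (N : Matrix (Fin a) (Fin b) ℂ) :
    ∃ P : Matrix (Fin b) (Fin a) ℂ, N * P * N = N := by
  obtain ⟨s, hs⟩ := (N.mulVecLin.rangeRestrict).exists_rightInverse_of_surjective
    (LinearMap.range_rangeRestrict _)
  obtain ⟨g, hg⟩ := LinearMap.exists_extend s
  refine ⟨LinearMap.toMatrix' g, ?_⟩
  apply Matrix.toLin'.injective
  apply LinearMap.ext
  intro x
  have h1 : g (N *ᵥ x) = s (N.mulVecLin.rangeRestrict x) := by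
    rw [← hg]; rfl
  have h2 : N.mulVecLin.rangeRestrict (s (N.mulVecLin.rangeRestrict x)) =
      N.mulVecLin.rangeRestrict x := LinearMap.congr_fun hs _
  have h3 := congrArg Subtype.val h2
  simp only [Matrix.toLin'_mul, LinearMap.comp_apply, Matrix.toLin'_toMatrix']
  simp only [Matrix.toLin'_apply]
  rw [h1]
  exact h3

theorem aux_range {a b c : ℕ} (U : Matrix (Fin a) (Fin b) ℂ) (V : Matrix (Fin a) (Fin c) ℂ)
    (h : LinearMap.range U.mulVecLin ≤ LinearMap.range V.mulVecLin) :
    ∃ P : Matrix (Fin c) (Fin b) ℂ, U = V * P := by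
  have : ∀ j, ∃ w, V *ᵥ w = U *ᵥ (Pi.single j 1) := fun j => h ⟨Pi.single j 1, rfl⟩
  choose w hw using this
  refine ⟨Matrix.of fun i j => w j i, ?_⟩
  ext i j
  have := congrFun (hw j) i
  simp only [Matrix.mulVec_single_one, Matrix.col_apply] at this
  rw [← this]; rfl

theorem aux_quad (q l : ℂ) (h : ∀ t : ℝ, 0 ≤ -((t : ℂ) ^ 2 * q) - t * l) : l = 0 := by
  have key : ∀ t : ℝ, 0 ≤ -(t ^ 2 * q.re) - t * l.re ∧ 0 = -(t ^ 2 * q.im) - t * l.im := by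
    intro t
    have := Complex.le_def.1 (h t)
    rw [← Complex.ofReal_pow] at this
    simpa only [Complex.sub_re, Complex.neg_re, Complex.re_ofReal_mul, Complex.sub_im,
      Complex.neg_im, Complex.im_ofReal_mul, Complex.zero_re, Complex.zero_im] using this
  have hd : discrim (-q.re) (-l.re) 0 ≤ 0 := discrim_le_zero fun t => by
    have := (key t).1; nlinarith
  apply Complex.ext
  · simp only [discrim] at hd
    simp only [Complex.zero_re]
    nlinarith
  · have h1 := (key 1).2
    have h2 := (key (-1)).2
    simp only [Complex.zero_im]
    linarith

theorem aux_lin {n : ℕ} (Q L : Matrix (Fin n) (Fin n) ℂ) (hL : L.IsHermitian)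
    (h : ∀ t : ℝ, (-((t : ℂ) ^ 2 • Q) - (t : ℂ) • L).PosSemidef) : L = 0 := by
  have hz : ∀ x : Fin n → ℂ, star x ⬝ᵥ (L *ᵥ x) = 0 := by
    intro x
    apply aux_quad (star x ⬝ᵥ (Q *ᵥ x))
    intro t
    have := (h t).dotProduct_mulVec_nonneg x
    simpa only [Matrix.sub_mulVec, Matrix.neg_mulVec, Matrix.smul_mulVec, dotProduct_sub,
      dotProduct_neg, dotProduct_smul, smul_eq_mul] using this
  have hp : L.PosSemidef := .of_dotProduct_mulVec_nonneg hL fun x => (hz x).ge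
  apply Matrix.toLin'.injective
  apply LinearMap.ext
  intro x
  simpa using (hp.dotProduct_mulVec_zero_iff x).1 (hz x)

theorem aux_expand {n m p q : ℕ}
    (A : Matrix (Fin n) (Fin p) ℂ) (B : Matrix (Fin m) (Fin q) ℂ)
    (C : Matrix (Fin n) (Fin q) ℂ) (D : Matrix (Fin n) (Fin n) ℂ)
    (M : Matrix (Fin q) (Fin q) ℂ) (hM : M.IsHermitian) (X Y : Matrix (Fin p) (Fin m) ℂ) :
    (((A * X * B + C) * M * (A * X * B + C)ᴴ + D) -
      ((A * (X + Y) * B + C) * M * (A * (X + Y) * B + C)ᴴ + D)) =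
    -((A * Y) * (B * M * Bᴴ) * (A * Y)ᴴ) -
      ((A * Y) * (A * X * (B * M * Bᴴ) + C * M * Bᴴ)ᴴ +
       (A * X * (B * M * Bᴴ) + C * M * Bᴴ) * (A * Y)ᴴ) := by
  have hM' : Mᴴ = M := hM
  simp only [Matrix.conjTranspose_add, Matrix.conjTranspose_mul, hM',
    Matrix.conjTranspose_conjTranspose, Matrix.mul_add, Matrix.add_mul, Matrix.mul_assoc]
  abel

theorem aux_scale {n m p : ℕ}
    (A : Matrix (Fin n) (Fin p) ℂ) (N : Matrix (Fin m) (Fin m) ℂ) (G : Matrix (Fin n) (Fin m) ℂ)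
    (h : ∀ Y : Matrix (Fin p) (Fin m) ℂ,
      (-((A * Y) * N * (A * Y)ᴴ) - ((A * Y) * Gᴴ + G * (A * Y)ᴴ)).PosSemidef)
    (Y : Matrix (Fin p) (Fin m) ℂ) : A * Y * Gᴴ = 0 := by
  have key : ∀ Y : Matrix (Fin p) (Fin m) ℂ, (A * Y) * Gᴴ + G * (A * Y)ᴴ = 0 := by
    intro Y
    apply aux_lin ((A * Y) * N * (A * Y)ᴴ)
    · simp [Matrix.IsHermitian, Matrix.conjTranspose_add, Matrix.conjTranspose_mul, add_comm,
        Matrix.mul_assoc]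
    · intro t
      have := h ((t : ℂ) • Y)
      have hs : star (t : ℂ) = t := Complex.conj_ofReal t
      simpa only [Matrix.mul_smul, Matrix.smul_mul, Matrix.conjTranspose_smul, hs, smul_smul,
        ← smul_add, ← pow_two] using this
  have h1 := key Y
  have h2 := key (Complex.I • Y)
  have hs : star Complex.I = -Complex.I := Complex.conj_I
  simp only [Matrix.mul_smul, Matrix.smul_mul, Matrix.conjTranspose_smul, hs, neg_smul,
    Matrix.mul_neg, ← sub_eq_add_neg, ← smul_sub] at h2
  have h3 := (smul_eq_zero.1 h2).resolve_left Complex.I_ne_zero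
  have h4 : (2 : ℂ) • (A * Y * Gᴴ) = 0 := by
    rw [two_smul]
    nth_rewrite 2 [sub_eq_zero.1 h3]
    exact h1
  exact (smul_eq_zero.1 h4).resolve_left two_ne_zero

theorem aux_unit {n p : ℕ} (A : Matrix (Fin n) (Fin p) ℂ) (hA : A ≠ 0) :
    ∃ (r : Matrix (Fin 1) (Fin n) ℂ) (c : Matrix (Fin p) (Fin 1) ℂ), r * A * c = 1 := by
  obtain ⟨i, j, hij⟩ : ∃ i j, A i j ≠ 0 := by
    by_contra! hc
    exact hA (Matrix.ext hc)
  refine ⟨Matrix.of fun _ => Pi.single i 1, Matrix.of fun k _ => if k = j then (A i j)⁻¹ else 0, ?_⟩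
  ext a b
  fin_cases a; fin_cases b
  simp [Matrix.mul_apply, Pi.single_apply, hij]

theorem aux_nec {n m p : ℕ}
    (A : Matrix (Fin n) (Fin p) ℂ) (N : Matrix (Fin m) (Fin m) ℂ) (G : Matrix (Fin n) (Fin m) ℂ)
    (hA : A ≠ 0) (hN : N.IsHermitian)
    (h : ∀ Y : Matrix (Fin p) (Fin m) ℂ,
      (-((A * Y) * N * (A * Y)ᴴ) - ((A * Y) * Gᴴ + G * (A * Y)ᴴ)).PosSemidef) :
    G = 0 ∧ (-N).PosSemidef := by
  obtain ⟨r, c, hrc⟩ := aux_unit A hA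
  have hG : G = 0 := by
    have hV : ∀ V : Matrix (Fin 1) (Fin m) ℂ, V * Gᴴ = 0 := by
      intro V
      have := congrArg (r * ·) (aux_scale A N G h (c * V))
      simp only [Matrix.mul_zero, ← Matrix.mul_assoc, hrc, Matrix.one_mul] at this
      exact this
    ext i k
    have := congrFun (congrFun (hV (Matrix.of fun _ => Pi.single k 1)) 0) i
    simpa [Matrix.mul_apply, Pi.single_apply] using this
  refine ⟨hG, .of_dotProduct_mulVec_nonneg hN.neg fun x => ?_⟩
  subst hG
  set V : Matrix (Fin 1) (Fin m) ℂ := Matrix.of fun _ => star x with hVdef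
  have h1 := (h (c * V)).mul_mul_conjTranspose_same r
  have e : r * (A * (c * V)) = V := by
    rw [← Matrix.mul_assoc, ← Matrix.mul_assoc, hrc, Matrix.one_mul]
  have h2 : r * (-((A * (c * V)) * N * (A * (c * V))ᴴ) - ((A * (c * V)) * (0 : Matrix (Fin n) (Fin m) ℂ)ᴴ
      + (0 : Matrix (Fin n) (Fin m) ℂ) * (A * (c * V))ᴴ)) * rᴴ = V * (-N) * Vᴴ := by
    conv_rhs => rw [← e]
    simp [Matrix.mul_assoc]
  rw [h2] at h1
  have h3 := h1.diag_nonneg (i := 0)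
  rw [Matrix.mul_assoc] at h3
  convert h3 using 1
  simp [Matrix.mul_apply, dotProduct, Matrix.mulVec, hVdef]

theorem stmt13 {n m p q : ℕ}
    (A : Matrix (Fin n) (Fin p) ℂ) (B : Matrix (Fin m) (Fin q) ℂ)
    (C : Matrix (Fin n) (Fin q) ℂ) (D : Matrix (Fin n) (Fin n) ℂ)
    (M : Matrix (Fin q) (Fin q) ℂ)
    (hD : D.IsHermitian) (hM : M.IsHermitian) (hA : A ≠ 0) :
    ((∃ Xtil : Matrix (Fin p) (Fin m) ℂ,
        ∀ X : Matrix (Fin p) (Fin m) ℂ,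
          (((A * Xtil * B + C) * M * (A * Xtil * B + C)ᴴ + D) -
            ((A * X * B + C) * M * (A * X * B + C)ᴴ + D)).PosSemidef) ↔
      (-(B * M * Bᴴ)).PosSemidef ∧
      LinearMap.range (C * M * Bᴴ).mulVecLin ≤ LinearMap.range A.mulVecLin ∧
      LinearMap.range (B * M * Cᴴ).mulVecLin ≤ LinearMap.range (B * M * Bᴴ).mulVecLin) ∧
    ((-(B * M * Bᴴ)).PosSemidef →
      LinearMap.range (C * M * Bᴴ).mulVecLin ≤ LinearMap.range A.mulVecLin →
      LinearMap.range (B * M * Cᴴ).mulVecLin ≤ LinearMap.range (B * M * Bᴴ).mulVecLin →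
      ∀ Xtil : Matrix (Fin p) (Fin m) ℂ,
        (∀ X : Matrix (Fin p) (Fin m) ℂ,
            (((A * Xtil * B + C) * M * (A * Xtil * B + C)ᴴ + D) -
              ((A * X * B + C) * M * (A * X * B + C)ᴴ + D)).PosSemidef) ↔
          A * Xtil * (B * M * Bᴴ) + C * M * Bᴴ = 0) := by
  have hN : (B * M * Bᴴ).IsHermitian := Matrix.isHermitian_mul_mul_conjTranspose B hM
  have nec : ∀ Xtil : Matrix (Fin p) (Fin m) ℂ,
      (∀ X : Matrix (Fin p) (Fin m) ℂ,
          (((A * Xtil * B + C) * M * (A * Xtil * B + C)ᴴ + D) -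
            ((A * X * B + C) * M * (A * X * B + C)ᴴ + D)).PosSemidef) →
      A * Xtil * (B * M * Bᴴ) + C * M * Bᴴ = 0 ∧ (-(B * M * Bᴴ)).PosSemidef := by
    intro Xtil h
    apply aux_nec A _ _ hA hN
    intro Y
    rw [← aux_expand A B C D M hM]
    exact h (Xtil + Y)
  have suf : (-(B * M * Bᴴ)).PosSemidef → ∀ Xtil : Matrix (Fin p) (Fin m) ℂ,
      A * Xtil * (B * M * Bᴴ) + C * M * Bᴴ = 0 →
      (∀ X : Matrix (Fin p) (Fin m) ℂ,
          (((A * Xtil * B + C) * M * (A * Xtil * B + C)ᴴ + D) -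
            ((A * X * B + C) * M * (A * X * B + C)ᴴ + D)).PosSemidef) := by
    intro hP Xtil hG X
    have := aux_expand A B C D M hM Xtil (X - Xtil)
    rw [add_sub_cancel, hG] at this
    rw [this]
    simpa using hP.mul_mul_conjTranspose_same (A * (X - Xtil))
  have hMC : (C * M * Bᴴ)ᴴ = B * M * Cᴴ := by
    simp [Matrix.conjTranspose_mul, hM.eq, Matrix.mul_assoc]
  refine ⟨⟨?_, ?_⟩, fun hP _ _ Xtil => ⟨fun h => (nec Xtil h).1, suf hP Xtil⟩⟩
  · rintro ⟨Xtil, h⟩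
    obtain ⟨hG, hP⟩ := nec Xtil h
    have h1 : C * M * Bᴴ = A * (-(Xtil * (B * M * Bᴴ))) := by
      rw [eq_neg_of_add_eq_zero_right hG, Matrix.mul_neg, Matrix.mul_assoc A]
    have h2 : B * M * Cᴴ = (B * M * Bᴴ) * (-(A * Xtil)ᴴ) := by
      rw [← hMC, eq_neg_of_add_eq_zero_right hG, Matrix.conjTranspose_neg,
        Matrix.conjTranspose_mul, hN.eq, Matrix.mul_neg]
    refine ⟨hP, ?_, ?_⟩
    · rw [h1, Matrix.mulVecLin_mul]
      exact LinearMap.range_comp_le_range _ _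
    · rw [h2, Matrix.mulVecLin_mul]
      exact LinearMap.range_comp_le_range _ _
  · rintro ⟨hP, hr1, hr2⟩
    obtain ⟨P, hP1⟩ := aux_range _ _ hr1
    obtain ⟨S, hS⟩ := aux_range _ _ hr2
    have hS' : C * M * Bᴴ = Sᴴ * (B * M * Bᴴ) := by
      rw [← Matrix.conjTranspose_conjTranspose (C * M * Bᴴ), hMC, hS,
        Matrix.conjTranspose_mul, hN.eq]
    obtain ⟨J, hJ⟩ := aux_inner_inv (B * M * Bᴴ)
    refine ⟨-(P * J), suf hP _ ?_⟩
    have : A * (P * J) * (B * M * Bᴴ) = C * M * Bᴴ := by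
      rw [← Matrix.mul_assoc A P J, ← hP1, hS']
      generalize B * M * Bᴴ = N at hJ
      rw [Matrix.mul_assoc, Matrix.mul_assoc, ← Matrix.mul_assoc N J, hJ]
    rw [Matrix.mul_neg, Matrix.neg_mul, this, neg_add_cancel]
end
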